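/- Let G = (V, E) be a finite simple graph, P ⊆ V a pinned set with |P| ≥ 3, and p : V → ℝ² a generic configuration such that the pinned framework (G, p, P) is isostatic. Fix an edge e = {u₀, v₀} ∈ E, let M ⊆ (ℝ²)^V be the set of configurations q with q(v) = p(v) for all v ∈ P and ‖q(u) − q(v)‖ = ‖p(u) − p(v)‖ for every edge {u, v} ∈ E \ {e}, and let M₀ be the connected component of M containing p. Then the set {q ∈ M₀ : ‖q(u₀) − q(v₀)‖ = ‖p(u₀) − p(v₀)‖} is finite, has even cardinality, and contains at least two elements. -/

import Mathlib

noncomputable section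

/-- The Euclidean plane ℝ². -/
abbrev Plane := EuclideanSpace ℝ (Fin 2)

/-- A configuration `p : V → ℝ^d` is generic if the `d|V|` coordinates of the points
are algebraically independent over ℚ. -/
def IsGenericConfig {V : Type*} (d : ℕ) (p : V → EuclideanSpace ℝ (Fin d)) : Prop :=
  AlgebraicIndependent ℚ (fun vi : V × Fin d => p vi.1 vi.2)

/-- The pinned rigidity matrix of the framework `(G, p)` with pinned set `P`:
one row per edge, two columns per free vertex; the row of an edge `{u, v}` contains
`p u - p v` in the columns of `u` when `u` is free, `p v - p u` in the columns of `v`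
when `v` is free, and zeros elsewhere. -/
def pinnedRigidityMatrix {V : Type*} [DecidableEq V] (G : SimpleGraph V) (P : Set V)
    [DecidablePred (· ∈ P)] (p : V → Plane) :
    Matrix G.edgeSet ({v : V // v ∉ P} × Fin 2) ℝ :=
  fun e vi =>
    if h : (vi.1 : V) ∈ (e : Sym2 V) then (p vi.1 - p (Sym2.Mem.other h)) vi.2 else 0

/-- The pinned framework `(G, p, P)` is isostatic: `|E| = 2|F|` where `F = V \ P`
is the set of free vertices, and the (square) pinned rigidity matrix is nonsingular,
i.e. has full rank. -/
def PinnedIsostatic {V : Type*} [Fintype V] [DecidableEq V] (G : SimpleGraph V)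
    [DecidableRel G.Adj] (P : Set V) [DecidablePred (· ∈ P)] (p : V → Plane) : Prop :=
  Fintype.card G.edgeSet = 2 * Fintype.card {v : V // v ∉ P} ∧
  (pinnedRigidityMatrix G P p).rank = 2 * Fintype.card {v : V // v ∉ P}

/-- The configuration space `M` obtained by removing the edge `e`: configurations `q`
agreeing with `p` on the pinned set `P` and having the same length as `p` on every
edge of `G` other than `e`.  It carries the subspace topology from `(ℝ²)^V`. -/
def flexSpace {V : Type*} (G : SimpleGraph V) (P : Set V) (p : V → Plane)
    (e : Sym2 V) : Set (V → Plane) :=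
  {q | (∀ v ∈ P, q v = p v) ∧
    ∀ ⦃u w : V⦄, G.Adj u w → s(u, w) ≠ e → dist (q u) (q w) = dist (p u) (p w)}


section Jacobian
open MvPolynomial

theorem formallySmooth_of_charZero (K L : Type*) [Field K] [Field L] [Algebra K L] [CharZero K] :
    Algebra.FormallySmooth K L := by
  obtain ⟨s, hs⟩ := exists_isTranscendenceBasis K L
  have : Algebra.IsAlgebraic
      (IntermediateField.adjoin K (Set.range ((↑) : s → L))) L := hs.isAlgebraic_field
  exact Algebra.FormallySmooth.of_algebraicIndependent_of_isSeparable hs.1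

theorem D_aeval {κ : Type*} [Fintype κ] {L : Type*} [CommRing L] [Algebra ℚ L]
    (y : κ → L) (g : MvPolynomial κ ℚ) :
    KaehlerDifferential.D ℚ L (aeval y g) =
      ∑ k, aeval y (pderiv k g) • KaehlerDifferential.D ℚ L (y k) := by
  classical
  induction g using MvPolynomial.induction_on with
  | C a => simp [← algebraMap_eq]
  | add p q hp hq => simp [hp, hq, add_smul, Finset.sum_add_distrib]
  | mul_X p i hp =>
    simp only [map_mul, Derivation.leibniz, aeval_X, hp, pderiv_X, smul_eq_mul, map_add, add_smul,
      Finset.sum_add_distrib, Finset.smul_sum, smul_smul]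
    congr 1
    rw [Finset.sum_eq_single i] <;> simp +contextual [eq_comm]

theorem linearIndependent_D {κ L : Type*} [Field L] [Algebra ℚ L] {y : κ → L}
    (hy : AlgebraicIndependent ℚ y) :
    LinearIndependent L (fun k => KaehlerDifferential.D ℚ L (y k)) := by
  let _ : Algebra (MvPolynomial κ ℚ) L := (aeval y : MvPolynomial κ ℚ →ₐ[ℚ] L).toAlgebra
  have : IsScalarTower ℚ (MvPolynomial κ ℚ) L := IsScalarTower.of_algHom (aeval y)
  have : FaithfulSMul (MvPolynomial κ ℚ) L :=
    (faithfulSMul_iff_algebraMap_injective _ _).2 hy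
  let _ : Algebra (FractionRing (MvPolynomial κ ℚ)) L := FractionRing.liftAlgebra _ _
  have : IsScalarTower (MvPolynomial κ ℚ) (FractionRing (MvPolynomial κ ℚ)) L :=
    FractionRing.isScalarTower_liftAlgebra _ _
  have := formallySmooth_of_charZero (FractionRing (MvPolynomial κ ℚ)) L
  have : Algebra.FormallySmooth (MvPolynomial κ ℚ) (FractionRing (MvPolynomial κ ℚ)) :=
    .of_isLocalization (nonZeroDivisors _)
  have : Algebra.FormallySmooth (MvPolynomial κ ℚ) L :=
    .comp _ (FractionRing (MvPolynomial κ ℚ)) _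
  have hinj : Function.Injective (KaehlerDifferential.mapBaseChange ℚ (MvPolynomial κ ℚ) L) := by
    rw [injective_iff_map_eq_zero]
    intro a ha
    obtain ⟨b, rfl⟩ := (Algebra.H1Cotangent.exact_δ_mapBaseChange ℚ (MvPolynomial κ ℚ) L a).1 ha
    rw [Subsingleton.elim b 0, map_zero]
  have hb := ((KaehlerDifferential.mvPolynomialBasis ℚ κ).baseChange L).linearIndependent
  have := hb.map' _ (LinearMap.ker_eq_bot.2 hinj)
  have he : (fun k => KaehlerDifferential.D ℚ L (y k)) =
      KaehlerDifferential.mapBaseChange ℚ (MvPolynomial κ ℚ) L ∘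
        (KaehlerDifferential.mvPolynomialBasis ℚ κ).baseChange L := by
    funext k
    simp [RingHom.algebraMap_toAlgebra]
  rw [he]
  exact this

theorem linearIndependent_jacobian {ι κ L : Type*} [Fintype ι] [Fintype κ] [Field L] [Algebra ℚ L]
    (f : κ → MvPolynomial ι ℚ) (q : ι → L)
    (h : AlgebraicIndependent ℚ (fun k => aeval q (f k))) :
    LinearIndependent L (fun k i => aeval q (pderiv i (f k))) := by
  have h1 := linearIndependent_D h
  simp_rw [D_aeval] at h1
  rw [Fintype.linearIndependent_iff] at h1 ⊢
  intro c hc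
  apply h1
  simp_rw [Finset.smul_sum, smul_smul]
  rw [Finset.sum_comm]
  simp_rw [← Finset.sum_smul]
  refine Finset.sum_eq_zero fun i _ => ?_
  have := congrFun hc i
  simp only [Finset.sum_apply, Pi.smul_apply, smul_eq_mul, Pi.zero_apply] at this
  rw [this, zero_smul]

theorem algebraicIndependent_of_linearIndependent_D {κ L : Type*} [Fintype κ] [Field L]
    [Algebra ℚ L] {y : κ → L}
    (hy : LinearIndependent L (fun k => KaehlerDifferential.D ℚ L (y k))) :
    AlgebraicIndependent ℚ y := by
  classical
  rw [algebraicIndependent_iff]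
  intro g hg
  induction hn : g.totalDegree using Nat.strong_induction_on generalizing g with
  | _ n ih =>
  have hd : ∀ k, pderiv k g = 0 := by
    intro k
    by_contra hne
    have h0 : aeval y (pderiv k g) = 0 := by
      have := D_aeval y g
      rw [hg, map_zero] at this
      exact Fintype.linearIndependent_iff.1 hy _ this.symm k
    have hlt : (pderiv k g).totalDegree < n := by
      obtain ⟨m, hm, hdeg⟩ := Finset.exists_mem_eq_sup _ (support_nonempty.2 hne)
        (fun m : κ →₀ ℕ => m.sum fun _ e => e)
      rw [mem_support_iff, coeff_pderiv] at hm
      have hle := le_totalDegree (mem_support_iff.2 (left_ne_zero_of_mul hm))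
      rw [Finsupp.sum_add_index' (by simp) (by simp), Finsupp.sum_single_index rfl] at hle
      rw [totalDegree, hdeg]
      omega
    exact hne (ih _ hlt _ h0 rfl)
  have hC : g = C (coeff 0 g) := by
    ext m
    rw [coeff_C]
    split_ifs with h0
    · rw [h0]
    · obtain ⟨k, hk⟩ := Finsupp.ne_iff.1 (Ne.symm h0)
      have hm : m - Finsupp.single k 1 + Finsupp.single k 1 = m :=
        tsub_add_cancel_of_le (Finsupp.single_le_iff.2 (Nat.one_le_iff_ne_zero.2 hk))
      have := coeff_pderiv (i := k) g (m - Finsupp.single k 1)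
      rw [hd k, coeff_zero, hm, eq_comm, mul_eq_zero] at this
      exact this.resolve_right (by positivity)
  rw [hC] at hg ⊢
  rw [aeval_C, FaithfulSMul.algebraMap_eq_zero_iff] at hg
  rw [hg, C_0]

theorem algebraicIndependent_of_jacobian {ι κ L : Type*} [Fintype ι] [Fintype κ] [Field L]
    [Algebra ℚ L] (f : κ → MvPolynomial ι ℚ) (q : ι → L) (hq : AlgebraicIndependent ℚ q)
    (h : LinearIndependent L (fun k i => aeval q (pderiv i (f k)))) :
    AlgebraicIndependent ℚ (fun k => aeval q (f k)) := by
  apply algebraicIndependent_of_linearIndependent_D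
  have h1 := linearIndependent_D hq
  simp_rw [D_aeval]
  rw [Fintype.linearIndependent_iff] at h h1 ⊢
  intro c hc
  apply h
  ext i
  simp only [Finset.sum_apply, Pi.smul_apply, smul_eq_mul, Pi.zero_apply]
  refine h1 (fun i => ∑ k, c k * aeval q (pderiv i (f k))) ?_ i
  rw [← hc]
  simp_rw [Finset.smul_sum, smul_smul, Finset.sum_smul]
  rw [Finset.sum_comm]

end Jacobian

section TransversalZeros
open Set Filter Topology

theorem eventually_sign_of_hasDerivAt {h : ℝ → ℝ} {h' z : ℝ} (hd : HasDerivAt h h' z)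
    (hz : h z = 0) (hne : h' ≠ 0) : ∀ᶠ t in 𝓝[≠] z, 0 < h t * ((t - z) * h') := by
  have h1 := hasDerivAt_iff_tendsto_slope.1 hd
  have h2 : ∀ᶠ t in 𝓝[≠] z, 0 < slope h z t * h' :=
    (h1.mul_const h').eventually (lt_mem_nhds (mul_self_pos.2 hne))
  filter_upwards [h2, self_mem_nhdsWithin] with t ht htz
  have h3 : 0 < (t - z) ^ 2 := by
    have : t - z ≠ 0 := sub_ne_zero.2 htz
    positivity
  have h4 : h t = slope h z t * (t - z) := by
    have : t - z ≠ 0 := sub_ne_zero.2 htz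
    rw [slope_def_field, hz]
    field_simp
    ring
  rw [h4]
  nlinarith [mul_pos ht h3]

theorem finite_zeros_Icc {h h' : ℝ → ℝ} (hd : ∀ t, HasDerivAt h (h' t) t)
    (hne : ∀ t, h t = 0 → h' t ≠ 0) (a b : ℝ) : {t ∈ Icc a b | h t = 0}.Finite := by
  have hcont : Continuous h := continuous_iff_continuousAt.2 fun t => (hd t).continuousAt
  have hcl : IsClosed {t ∈ Icc a b | h t = 0} :=
    isClosed_Icc.inter (isClosed_eq hcont continuous_const)
  have hcomp : IsCompact {t ∈ Icc a b | h t = 0} :=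
    isCompact_Icc.of_isClosed_subset hcl fun t ht => ht.1
  refine hcomp.finite (isDiscrete_iff_nhdsNE.2 fun z hz => ?_)
  rw [← disjoint_iff, disjoint_principal_right]
  filter_upwards [eventually_sign_of_hasDerivAt (hd z) hz.2 (hne z hz.2)] with t ht htz
  simp [htz.2] at ht

theorem mul_pos_of_forall_ne_zero {h : ℝ → ℝ} (hc : Continuous h) {a b : ℝ} (hab : a ≤ b)
    (hne : ∀ t ∈ Icc a b, h t ≠ 0) : 0 < h a * h b := by
  by_contra hcon
  have ha := hne a ⟨le_rfl, hab⟩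
  have hb := hne b ⟨hab, le_rfl⟩
  have key : ∃ t ∈ Icc a b, h t = 0 := by
    rcases lt_or_gt_of_ne ha with ha | ha
    · exact intermediate_value_Icc hab hc.continuousOn ⟨ha.le, by nlinarith⟩
    · exact intermediate_value_Icc' hab hc.continuousOn ⟨by nlinarith, ha.le⟩
  obtain ⟨t, ht, h0⟩ := key
  exact hne t ht h0

theorem even_ncard_zeros_Icc_iff {h h' : ℝ → ℝ} (hd : ∀ t, HasDerivAt h (h' t) t)
    (hne : ∀ t, h t = 0 → h' t ≠ 0) {a b : ℝ} (hab : a ≤ b) (ha : h a ≠ 0) (hb : h b ≠ 0) :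
    Even {t ∈ Icc a b | h t = 0}.ncard ↔ 0 < h a * h b := by
  have hcont : Continuous h := continuous_iff_continuousAt.2 fun t => (hd t).continuousAt
  have hfin := fun b => finite_zeros_Icc hd hne a b
  induction hn : {t ∈ Icc a b | h t = 0}.ncard generalizing b with
  | zero =>
    rw [Set.ncard_eq_zero (hfin b)] at hn
    refine iff_of_true Even.zero (mul_pos_of_forall_ne_zero hcont hab fun t ht h0 => ?_)
    exact (hn.subset ⟨ht, h0⟩ : t ∈ (∅ : Set ℝ))
  | succ n ih =>
    have hnon : {t ∈ Icc a b | h t = 0}.Nonempty := by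
      rw [← Set.ncard_pos (hfin b)]; omega
    obtain ⟨z, ⟨hz, hz0⟩, hmax⟩ := Set.exists_max_image _ id (hfin b) hnon
    have hzmax : ∀ t, t ∈ Icc a b → h t = 0 → t ≤ z := fun t h1 h2 => hmax t ⟨h1, h2⟩
    have haz : a < z := lt_of_le_of_ne hz.1 fun e => ha (e ▸ hz0)
    have hzb : z < b := lt_of_le_of_ne hz.2 fun e => hb (e ▸ hz0)
    have hsign := eventually_sign_of_hasDerivAt (hd z) hz0 (hne z hz0)
    obtain ⟨l, hl, hl'⟩ := (mem_nhdsLT_iff_exists_Ioo_subset' haz).1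
      (show _ ∈ 𝓝[<] z from nhdsWithin_mono z (fun x hx => ne_of_lt hx) hsign)
    obtain ⟨r, hr, hr'⟩ := (mem_nhdsGT_iff_exists_Ioo_subset' hzb).1
      (show _ ∈ 𝓝[>] z from nhdsWithin_mono z (fun x hx => ne_of_gt hx) hsign)
    obtain ⟨c, hc1, hc2⟩ := exists_between (max_lt hl haz)
    obtain ⟨d, hd1, hd2⟩ := exists_between (lt_min hr hzb)
    rw [max_lt_iff] at hc1
    rw [lt_min_iff] at hd2
    have hcs := hl' ⟨hc1.1, hc2⟩
    have hds := hr' ⟨hd1, hd2.1⟩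
    simp only [mem_ofPred_eq] at hcs hds
    have hc0 : h c ≠ 0 := fun e => by simp [e] at hcs
    have hcd : h c * h d < 0 := by
      have h1 := mul_pos hcs hds
      have h2 : 0 < (z - c) * (d - z) * (h' z * h' z) :=
        mul_pos (mul_pos (by linarith) (by linarith)) (mul_self_pos.2 (hne z hz0))
      by_contra hcon
      nlinarith [mul_nonneg (not_lt.1 hcon) h2.le]
    have hdb : 0 < h d * h b := mul_pos_of_forall_ne_zero hcont hd2.2.le fun t ht h0 => by
      have := hzmax t ⟨by linarith [ht.1], ht.2⟩ h0
      linarith [ht.1]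
    have hset : {t ∈ Icc a c | h t = 0} = {t ∈ Icc a b | h t = 0} \ {z} := by
      ext t
      simp only [mem_ofPred_eq, mem_Icc, Set.mem_sdiff, mem_singleton_iff]
      constructor
      · rintro ⟨⟨h1, h2⟩, h3⟩
        exact ⟨⟨⟨h1, by linarith⟩, h3⟩, by linarith⟩
      · rintro ⟨⟨⟨h1, h2⟩, h3⟩, h4⟩
        refine ⟨⟨h1, not_lt.1 fun hlt => ?_⟩, h3⟩
        have htz : t < z := lt_of_le_of_ne (hzmax t ⟨h1, h2⟩ h3) h4
        have := hl' (show t ∈ Ioo l z from ⟨by linarith, htz⟩)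
        simp [h3] at this
    have hcard : {t ∈ Icc a c | h t = 0}.ncard = n := by
      have hzmem : z ∈ {t ∈ Icc a b | h t = 0} := ⟨hz, hz0⟩
      rw [hset, Set.ncard_sdiff_singleton_of_mem hzmem, hn]
      rfl
    have := ih hc1.2.le hc0 hcard
    refine Nat.even_add_one.trans ((not_congr this).trans ?_)
    have hc2 := mul_self_pos.2 hc0
    have hd2 := mul_self_pos.2 (left_ne_zero_of_mul hdb.ne')
    constructor
    · intro hac
      have hac' : h a * h c < 0 := lt_of_le_of_ne (not_lt.1 hac) (mul_ne_zero ha hc0)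
      by_contra hcon
      nlinarith [mul_pos (mul_pos_of_neg_of_neg hac' hcd) hdb, mul_pos hc2 hd2]
    · intro hab' hac
      nlinarith [mul_neg_of_pos_of_neg (mul_pos hac hdb) hcd, mul_pos hab' (mul_pos hc2 hd2)]

open scoped NNReal

section Flow
variable {E : Type*} [NormedAddCommGroup E] [NormedSpace ℝ E] {X : E → E} {K L : ℝ≥0}

theorem exists_integralCurve [CompleteSpace E] (hX : LipschitzWith K X) (hL : ∀ x, ‖X x‖ ≤ L)
    (x : E) : ∃ γ : ℝ → E, γ 0 = x ∧ ∀ t, HasDerivAt γ (X (γ t)) t := by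
  have key : ∀ n : ℕ, ∃ α : ℝ → E, α 0 = x ∧
      ∀ t ∈ Ioo (-(n + 1 : ℝ)) (n + 1), HasDerivAt α (X (α t)) t := by
    intro n
    have hpl : IsPicardLindelof (fun _ => X) (tmin := -(n + 1 : ℝ)) (tmax := n + 1)
        ⟨0, by constructor <;> linarith [n.cast_nonneg (α := ℝ)]⟩ x (L * (n + 1)) 0 L K := by
      refine .of_time_independent (fun y _ => hL y) hX.lipschitzOnWith ?_
      simp
    obtain ⟨α, h0, hα⟩ := hpl.exists_eq_forall_mem_Icc_hasDerivWithinAt₀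
    exact ⟨α, h0, fun t ht => (hα t (Ioo_subset_Icc_self ht)).hasDerivAt (Icc_mem_nhds ht.1 ht.2)⟩
  choose α h0 hα using key
  have huniq : ∀ m n : ℕ, m ≤ n → ∀ t ∈ Ioo (-(m + 1 : ℝ)) (m + 1), α n t = α m t := by
    intro m n hmn t ht
    have hmn' : (m : ℝ) ≤ n := by exact_mod_cast hmn
    refine ODE_solution_unique_of_mem_Ioo (v := fun _ => X) (s := fun _ => univ) (t₀ := 0) (K := K)
      (a := -(m + 1 : ℝ)) (b := m + 1)
      (fun _ _ => hX.lipschitzOnWith) (by constructor <;> linarith [m.cast_nonneg (α := ℝ)])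
      (fun s hs => ⟨hα n s ⟨by linarith [hs.1], by linarith [hs.2]⟩, mem_univ _⟩)
      (fun s hs => ⟨hα m s hs, mem_univ _⟩) ((h0 n).trans (h0 m).symm) ht
  have hmem : ∀ t : ℝ, t ∈ Ioo (-((⌈|t|⌉₊ : ℕ) + 1 : ℝ)) ((⌈|t|⌉₊ : ℕ) + 1) := fun t => by
    rw [mem_Ioo, ← abs_lt]
    linarith [Nat.le_ceil |t|]
  refine ⟨fun t => α ⌈|t|⌉₊ t, by simpa using h0 _, fun t => ?_⟩
  have hloc : (fun s => α ⌈|s|⌉₊ s) =ᶠ[𝓝 t] α ⌈|t|⌉₊ := by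
    filter_upwards [isOpen_Ioo.mem_nhds (hmem t)] with s hs
    rcases le_total ⌈|t|⌉₊ ⌈|s|⌉₊ with h | h
    · exact huniq _ _ h s hs
    · exact (huniq _ _ h s (hmem s)).symm
  exact (hα _ t (hmem t)).congr_of_eventuallyEq hloc

theorem integralCurve_unique (hX : LipschitzWith K X) {γ δ : ℝ → E}
    (hγ : ∀ t, HasDerivAt γ (X (γ t)) t) (hδ : ∀ t, HasDerivAt δ (X (δ t)) t) {s t : ℝ}
    (h : γ s = δ t) (r : ℝ) : γ (s + r) = δ (t + r) := by
  have h1 : ∀ r, HasDerivAt (fun r => γ (s + r)) (X (γ (s + r))) r := fun r => by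
    simpa using (hγ (s + r)).comp_const_add s r
  have h2 : ∀ r, HasDerivAt (fun r => δ (t + r)) (X (δ (t + r))) r := fun r => by
    simpa using (hδ (t + r)).comp_const_add t r
  exact congrFun (ODE_solution_unique_univ (v := fun _ => X) (s := fun _ => univ) (t₀ := 0)
    (fun _ => hX.lipschitzOnWith) (fun r => ⟨h1 r, mem_univ _⟩) (fun r => ⟨h2 r, mem_univ _⟩)
    (by simpa using h)) r

theorem image_Ioo_mem_nhdsWithin (hX : Continuous X) {M U : Set E} {γ : ℝ → E}
    (hγ : ∀ t, HasDerivAt γ (X (γ t)) t) (hM : ∀ t, γ t ∈ M) {s : ℝ} (hU : U ∈ 𝓝 (γ s))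
    (l : E →L[ℝ] ℝ) (hl : l (X (γ s)) ≠ 0) (hinj : InjOn l (U ∩ M)) {ε : ℝ} (hε : 0 < ε) :
    γ '' Ioo (s - ε) (s + ε) ∈ 𝓝[M] (γ s) := by
  have hcont : Continuous γ := continuous_iff_continuousAt.2 fun t => (hγ t).continuousAt
  have hd : ∀ t, HasDerivAt (fun t => l (γ t)) (l (X (γ t))) t := fun t =>
    l.hasFDerivAt.comp_hasDerivAt t (hγ t)
  have hs : HasStrictDerivAt (fun t => l (γ t)) (l (X (γ s))) s :=
    hasStrictDerivAt_of_hasDerivAt_of_continuousAt (Eventually.of_forall hd)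
      (by fun_prop)
  have hV : Ioo (s - ε) (s + ε) ∩ γ ⁻¹' U ∈ 𝓝 s :=
    inter_mem (Ioo_mem_nhds (by linarith) (by linarith)) (hcont.continuousAt hU)
  have h1 : (fun t => l (γ t)) '' (Ioo (s - ε) (s + ε) ∩ γ ⁻¹' U) ∈ 𝓝 (l (γ s)) := by
    rw [← hs.map_nhds_eq hl]
    exact image_mem_map hV
  have h2 := l.continuous.continuousAt h1
  filter_upwards [mem_nhdsWithin_of_mem_nhds h2, mem_nhdsWithin_of_mem_nhds hU,
    self_mem_nhdsWithin] with x hx hxU hxM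
  obtain ⟨t, ⟨ht, htU⟩, hlt⟩ := hx
  exact ⟨t, ht, hinj ⟨htU, hM t⟩ ⟨hxU, hxM⟩ hlt⟩

theorem exists_periodic_parametrization [CompleteSpace E] (hX : LipschitzWith K X)
    (hL : ∀ x, ‖X x‖ ≤ L) {M : Set E} (hMc : IsCompact M)
    (hinv : ∀ γ : ℝ → E, (∀ t, HasDerivAt γ (X (γ t)) t) → γ 0 ∈ M → ∀ t, γ t ∈ M)
    (hloc : ∀ q ∈ M, ∃ U ∈ 𝓝 q, ∃ l : E →L[ℝ] ℝ, l (X q) ≠ 0 ∧ InjOn l (U ∩ M))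
    {p : E} (hp : p ∈ M) :
    ∃ γ : ℝ → E, (∀ t, HasDerivAt γ (X (γ t)) t) ∧ range γ = connectedComponentIn M p ∧
      ∃ T > 0, Function.Periodic γ T ∧ ∀ a, InjOn γ (Ico a (a + T)) := by
  obtain ⟨γ, h0, hγ⟩ := exists_integralCurve hX hL p
  have hcont : Continuous γ := continuous_iff_continuousAt.2 fun t => (hγ t).continuousAt
  have hγM : ∀ t, γ t ∈ M := hinv γ hγ (h0 ▸ hp)
  have hnhds : ∀ δ : ℝ → E, (∀ t, HasDerivAt δ (X (δ t)) t) → (∀ t, δ t ∈ M) → ∀ s,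
      δ '' Ioo (s - 1) (s + 1) ∈ 𝓝[M] (δ s) := fun δ hδ hδM s => by
    obtain ⟨U, hU, l, hl, hinj⟩ := hloc (δ s) (hδM s)
    exact image_Ioo_mem_nhdsWithin hX.continuous hδ hδM hU l hl hinj one_pos
  have hrange : range γ = connectedComponentIn M p := by
    apply Subset.antisymm
    · exact (isPreconnected_range hcont).subset_connectedComponentIn ⟨0, h0⟩
        (range_subset_iff.2 hγM)
    · intro y hy
      have := isPreconnected_connectedComponentIn.induction₂
        (s := connectedComponentIn M p)
        (fun x y => ∃ δ : ℝ → E, (∀ t, HasDerivAt δ (X (δ t)) t) ∧ x ∈ range δ ∧ y ∈ range δ)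
        (fun x hx => by
          obtain ⟨δ, hδ0, hδ⟩ := exists_integralCurve hX hL x
          have hxM := connectedComponentIn_subset _ _ hx
          have := hnhds δ hδ (hinv δ hδ (hδ0 ▸ hxM)) 0
          rw [hδ0] at this
          filter_upwards [nhdsWithin_mono _ (connectedComponentIn_subset M p) this] with z hz
          exact ⟨δ, hδ, ⟨0, hδ0⟩, image_subset_range _ _ hz⟩)
        (fun x y z _ _ _ => by
          rintro ⟨δ, hδ, hx, s, hs⟩ ⟨η, hη, ⟨t, ht⟩, r, hr⟩
          refine ⟨δ, hδ, hx, s + (r - t), ?_⟩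
          rw [integralCurve_unique hX hδ hη (hs.trans ht.symm), ← hr]
          congr 1
          ring)
        (fun x y _ _ => by
          rintro ⟨δ, hδ, hx, hy⟩
          exact ⟨δ, hδ, hy, hx⟩)
        (mem_connectedComponentIn hp) hy
      obtain ⟨δ, hδ, ⟨s, hs⟩, t, ht⟩ := this
      refine ⟨0 + (t - s), ?_⟩
      rw [integralCurve_unique hX hγ hδ (h0.trans hs.symm), ← ht]
      congr 1
      ring
  refine ⟨γ, hγ, hrange, ?_⟩
  have : CompactSpace M := isCompact_iff_compactSpace.1 hMc
  have hcomp : IsCompact (range γ) := by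
    rw [hrange, connectedComponentIn_eq_image hp]
    exact ((isClosed_connectedComponent.isCompact (X := M)).image continuous_subtype_val)
  have hper : ∀ s t, γ s = γ t → Function.Periodic γ (s - t) := fun s t hst r => by
    have := integralCurve_unique hX hγ hγ hst (r - t)
    rw [show t + (r - t) = r by ring] at this
    rw [← this]
    congr 1
    ring
  obtain ⟨s₁, t₁, hst, hγst⟩ : ∃ s t, s ≠ t ∧ γ s = γ t := by
    obtain ⟨x, ⟨s, rfl⟩, hx⟩ := hcomp.exists_mapClusterPt (f := (atTop : Filter ℕ))
      (u := fun n : ℕ => γ n) (by simp)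
    have h1 := hnhds γ hγ hγM s
    rw [mem_nhdsWithin_iff_exists_mem_nhds_inter] at h1
    obtain ⟨u, hu, hsub⟩ := h1
    have hfreq := (mapClusterPt_iff_frequently.1 hx) u hu
    obtain ⟨n, hn, hnu⟩ := frequently_atTop.1 hfreq ⌈s + 1⌉₊
    obtain ⟨t, ht, hte⟩ := hsub ⟨hnu, hγM _⟩
    refine ⟨t, n, ?_, hte⟩
    have := Nat.ceil_le.1 hn
    exact ne_of_lt (by linarith [ht.2])
  let S : AddSubgroup ℝ :=
    { carrier := {c | Function.Periodic γ c}
      zero_mem' := fun x => by simp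
      add_mem' := fun ha hb => ha.add_period hb
      neg_mem' := fun ha => ha.neg }
  have hSmem : ∀ c, c ∈ S ↔ Function.Periodic γ c := fun c => Iff.rfl
  rcases S.dense_or_cyclic with hS | ⟨T, hT⟩
  · exfalso
    have hcl : IsClosed (S : Set ℝ) := by
      have : (S : Set ℝ) = ⋂ x, {c | γ (x + c) = γ x} := by
        ext c
        simp [hSmem, Function.Periodic]
      rw [this]
      exact isClosed_iInter fun x => isClosed_eq (by fun_prop) continuous_const
    have huniv : ∀ c, γ c = γ 0 := fun c => by
      have : c ∈ (S : Set ℝ) := by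
        rw [← hcl.closure_eq]
        exact hS c
      simpa using this 0
    have hconst : γ = fun _ => γ 0 := funext huniv
    have hd := hγ 0
    rw [hconst] at hd
    have hX0 := hd.unique (hasDerivAt_const 0 (γ 0))
    obtain ⟨U, hU, l, hl, -⟩ := hloc p hp
    rw [h0] at hX0
    exact hl (by rw [hX0, map_zero])
  · have hTmem : ∀ c, c ∈ S ↔ ∃ n : ℤ, n • T = c := fun c => by
      rw [hT, AddSubgroup.mem_closure_singleton]
    have hT0 : T ≠ 0 := by
      rintro rfl
      obtain ⟨n, hn⟩ := (hTmem _).1 (hper _ _ hγst)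
      exact hst (sub_eq_zero.1 (by simpa using hn.symm))
    refine ⟨|T|, abs_pos.2 hT0, ?_, ?_⟩
    · have hTS : T ∈ S := (hTmem T).2 ⟨1, one_zsmul T⟩
      rcases abs_choice T with h | h <;> rw [h]
      · exact hTS
      · exact S.neg_mem hTS
    · intro a s hs t ht hst'
      obtain ⟨n, hn⟩ := (hTmem _).1 (hper _ _ hst')
      have hlt : |n • T| < |T| := by
        rw [hn, abs_lt]
        constructor <;> linarith [hs.1, hs.2, ht.1, ht.2]
      rw [zsmul_eq_mul, abs_mul] at hlt
      have hn1 : |(n : ℝ)| < 1 := by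
        by_contra hcon
        nlinarith [abs_pos.2 hT0]
      have hn0 : n = 0 := by
        rw [← Int.abs_lt_one_iff]
        exact_mod_cast hn1
      rw [hn0, zero_smul] at hn
      linarith

theorem finite_and_even_ncard_zeros [CompleteSpace E] (hX : LipschitzWith K X)
    (hL : ∀ x, ‖X x‖ ≤ L) {M : Set E} (hMc : IsCompact M)
    (hinv : ∀ γ : ℝ → E, (∀ t, HasDerivAt γ (X (γ t)) t) → γ 0 ∈ M → ∀ t, γ t ∈ M)
    (hloc : ∀ q ∈ M, ∃ U ∈ 𝓝 q, ∃ l : E →L[ℝ] ℝ, l (X q) ≠ 0 ∧ InjOn l (U ∩ M))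
    {g : E → ℝ} {g' : E → E →L[ℝ] ℝ} (hg : ∀ x, HasFDerivAt g (g' x) x)
    (hgt : ∀ x ∈ M, g x = 0 → g' x (X x) ≠ 0) {p : E} (hp : p ∈ M) :
    {x ∈ connectedComponentIn M p | g x = 0}.Finite ∧
      Even {x ∈ connectedComponentIn M p | g x = 0}.ncard := by
  obtain ⟨γ, hγ, hrange, T, hT, hper, hinj⟩ :=
    exists_periodic_parametrization hX hL hMc hinv hloc hp
  have hγM : ∀ t, γ t ∈ M := fun t =>
    connectedComponentIn_subset M p (hrange ▸ mem_range_self t)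
  have hd : ∀ t, HasDerivAt (fun t => g (γ t)) (g' (γ t) (X (γ t))) t := fun t =>
    (hg (γ t)).comp_hasDerivAt t (hγ t)
  have hne : ∀ t, g (γ t) = 0 → g' (γ t) (X (γ t)) ≠ 0 := fun t => hgt _ (hγM t)
  obtain ⟨a, ha⟩ : ∃ a, g (γ a) ≠ 0 := by
    by_contra! hall
    have h1 := hd 0
    simp_rw [hall] at h1
    exact hne 0 (hall 0) (h1.unique (hasDerivAt_const _ _))
  have haT : γ (a + T) = γ a := hper a
  have himage : {x ∈ connectedComponentIn M p | g x = 0} =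
      γ '' {t ∈ Icc a (a + T) | g (γ t) = 0} := by
    ext x
    rw [← hrange]
    constructor
    · rintro ⟨⟨t, rfl⟩, ht⟩
      obtain ⟨s, hs, hst⟩ := hper.exists_mem_Ico hT t a
      exact ⟨s, ⟨Ico_subset_Icc_self hs, show g (γ s) = 0 by rw [← hst, ht]⟩, hst.symm⟩
    · rintro ⟨t, ht, rfl⟩
      exact ⟨mem_range_self t, ht.2⟩
  have hinj' : InjOn γ {t ∈ Icc a (a + T) | g (γ t) = 0} := by
    have hsub : {t ∈ Icc a (a + T) | g (γ t) = 0} ⊆ Ico a (a + T) := fun t ht =>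
      ⟨ht.1.1, lt_of_le_of_ne ht.1.2 fun h => ha <| by rw [← haT, ← h]; exact ht.2⟩
    exact (hinj a).mono hsub
  rw [himage, hinj'.ncard_image]
  refine ⟨(finite_zeros_Icc hd hne a (a + T)).image γ, ?_⟩
  rw [even_ncard_zeros_Icc_iff hd hne (by linarith) ha (haT ▸ ha), haT]
  exact mul_self_pos.2 ha

end Flow

end TransversalZeros

noncomputable section PolynomialSystem
open MvPolynomial
variable {ι : Type*} [Fintype ι]

theorem contDiff_aeval (P : MvPolynomial ι ℚ) :
    ContDiff ℝ 1 (fun x : ι → ℝ => aeval x P) := by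
  induction P using MvPolynomial.induction_on with
  | C a => simpa [← algebraMap_eq] using contDiff_const
  | add p q hp hq => simpa using hp.add hq
  | mul_X p i hp => simpa using hp.mul (contDiff_apply ℝ ℝ i)

theorem exists_cutoff_vectorField (c : ι → MvPolynomial ι ℚ) {M : Set (ι → ℝ)}
    (hM : Bornology.IsBounded M) :
    ∃ (χ : (ι → ℝ) → ℝ) (K L : NNReal),
      LipschitzWith K (fun x => χ x • fun i => aeval x (c i)) ∧
      (∀ x, ‖χ x • fun i => aeval x (c i)‖ ≤ L) ∧ ∀ x ∈ M, χ x = 1 := by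
  obtain ⟨R, hR0, hR⟩ := hM.subset_closedBall_lt 0 0
  let χ : ContDiffBump (0 : ι → ℝ) := ⟨R, R + 1, hR0, by linarith⟩
  have hsm : ContDiff ℝ 1 (fun x => χ x • fun i => aeval x (c i)) :=
    χ.contDiff.smul (contDiff_pi.2 fun i => contDiff_aeval (c i))
  have hcs : HasCompactSupport (fun x => χ x • fun i => aeval x (c i)) :=
    χ.hasCompactSupport.smul_right
  obtain ⟨K, hK⟩ := hsm.lipschitzWith_of_hasCompactSupport hcs one_ne_zero
  obtain ⟨L, hL⟩ := hcs.exists_bound_of_continuous hsm.continuous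
  exact ⟨χ, K, L.toNNReal, hK, fun x => (hL x).trans (Real.le_coe_toNNReal L),
    fun x hx => χ.one_of_mem_closedBall (hR hx)⟩

variable [DecidableEq ι]

theorem hasStrictFDerivAt_aeval (P : MvPolynomial ι ℚ) (x : ι → ℝ) :
    HasStrictFDerivAt (fun x : ι → ℝ => aeval x P)
      (∑ i, aeval x (pderiv i P) • ContinuousLinearMap.proj (R := ℝ) (φ := fun _ : ι => ℝ) i) x := by
  induction P using MvPolynomial.induction_on with
  | C a =>
    simpa [← algebraMap_eq] using hasStrictFDerivAt_const (𝕜 := ℝ) (algebraMap ℚ ℝ a) x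
  | add p q hp hq =>
    simp only [map_add, add_smul, Finset.sum_add_distrib]
    exact hp.add hq
  | mul_X p i hp =>
    have h := hp.mul (hasStrictFDerivAt_apply (𝕜 := ℝ) i x)
    simp only [map_mul, aeval_X]
    refine h.congr_fderiv ?_
    ext j
    simp [Finset.smul_sum, pderiv_X, Pi.single_apply, add_mul, apply_ite (aeval x : _ → ℝ), ite_mul,
      Finset.sum_add_distrib, mul_assoc]

def jacobianMatrix (f : ι → MvPolynomial ι ℚ) : Matrix ι ι (MvPolynomial ι ℚ) :=
  Matrix.of fun k i => pderiv i (f k)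

theorem sum_jacobian_mul_adjugate (f : ι → MvPolynomial ι ℚ) (x : ι → ℝ) (k k₀ : ι) :
    ∑ i, aeval x (pderiv i (f k)) * aeval x ((jacobianMatrix f).adjugate i k₀) =
      if k = k₀ then aeval x (jacobianMatrix f).det else 0 := by
  have h := congr_fun (congr_fun (Matrix.mul_adjugate (jacobianMatrix f)) k) k₀
  have h2 := congr_arg (aeval x : _ → ℝ) h
  simpa [Matrix.mul_apply, Matrix.one_apply, apply_ite (aeval x : _ → ℝ),
    jacobianMatrix] using h2

theorem sum_mul_aeval_adjugate (f : ι → MvPolynomial ι ℚ) (x : ι → ℝ) (k₀ : ι) (w : ι → ℝ) :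
    ∑ i, w i * aeval x ((jacobianMatrix f).adjugate i k₀) =
      (((jacobianMatrix f).map (aeval x)).updateRow k₀ w).det := by
  have h : ∀ i, aeval x ((jacobianMatrix f).adjugate i k₀) =
      ((jacobianMatrix f).map (aeval x)).adjugate i k₀ := by
    intro i
    have := AlgHom.map_adjugate (aeval x : MvPolynomial ι ℚ →ₐ[ℚ] ℝ) (jacobianMatrix f)
    exact congr_fun (congr_fun this i) k₀
  rw [Matrix.det_eq_sum_mul_adjugate_row _ k₀]
  refine Finset.sum_congr rfl fun i _ => ?_
  rw [h, Matrix.adjugate_apply, Matrix.adjugate_apply, Matrix.updateRow_idem, Matrix.updateRow_self]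

theorem exists_det_updateRow_ne_zero {L : Type*} [Field L] (A : Matrix ι ι L) (k₀ : ι)
    (h : LinearIndependent L (fun k : {k // k ≠ k₀} => A k)) :
    ∃ w, (A.updateRow k₀ w).det ≠ 0 := by
  have hlt : Submodule.span L (A.row '' {k | k ≠ k₀}) < ⊤ := by
    refine Submodule.lt_top_of_finrank_lt_finrank ?_
    calc _ ≤ Fintype.card {k // k ≠ k₀} := by
          rw [Set.image_eq_range]
          exact finrank_range_le_card (fun k : {k // k ≠ k₀} => A.row k)
      _ < Fintype.card ι := Fintype.card_subtype_lt (x := k₀) (by simp)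
      _ = _ := (Module.finrank_fintype_fun_eq_card L).symm
  obtain ⟨w, -, hw⟩ := SetLike.exists_of_lt hlt
  refine ⟨w, ?_⟩
  rw [← isUnit_iff_ne_zero, ← Matrix.isUnit_iff_isUnit_det,
    ← Matrix.linearIndependent_rows_iff_isUnit, ← linearIndepOn_univ_iff]
  have : (Set.univ : Set ι) = insert k₀ {k | k ≠ k₀} := by
    ext k; simp [em]
  have hs : (A.updateRow k₀ w).row '' {k | k ≠ k₀} = A.row '' {k | k ≠ k₀} :=
    Set.image_congr fun k hk => Matrix.updateRow_ne hk
  rw [this, linearIndepOn_insert (by simp), hs]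
  constructor
  · refine LinearIndepOn.congr (v := A.row) h ?_
    intro k hk
    exact (Matrix.updateRow_ne hk).symm
  · simpa [Matrix.row] using hw

theorem exists_nhds_injOn (f : ι → MvPolynomial ι ℚ) (k₀ : ι) (q : ι → ℝ)
    (h : LinearIndependent ℝ (fun k : {k // k ≠ k₀} => fun i => aeval q (pderiv i (f k)))) :
    ∃ U ∈ nhds q, ∃ l : (ι → ℝ) →L[ℝ] ℝ,
      l (fun i => aeval q ((jacobianMatrix f).adjugate i k₀)) ≠ 0 ∧
      Set.InjOn l (U ∩ {x | ∀ k ≠ k₀, aeval x (f k) = aeval q (f k)}) := by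
  obtain ⟨w, hw⟩ := exists_det_updateRow_ne_zero ((jacobianMatrix f).map (aeval q)) k₀ h
  set B := ((jacobianMatrix f).map (aeval q)).updateRow k₀ w with hB
  let l : (ι → ℝ) →L[ℝ] ℝ := ∑ i, w i • ContinuousLinearMap.proj (R := ℝ) (φ := fun _ : ι => ℝ) i
  have hl : ∀ x, l x = ∑ i, w i * x i := fun x => by simp [l]
  let B' : (ι → ℝ) ≃L[ℝ] (ι → ℝ) :=
    (Matrix.toLin'OfInv (B.nonsing_inv_mul hw.isUnit)
      (B.mul_nonsing_inv hw.isUnit)).toContinuousLinearEquiv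
  let H : (ι → ℝ) → ι → ℝ := fun x k => if k = k₀ then l x else aeval x (f k)
  have hH : HasStrictFDerivAt H (B' : (ι → ℝ) →L[ℝ] (ι → ℝ)) q := by
    rw [hasStrictFDerivAt_pi']
    intro k
    by_cases hk : k = k₀
    · subst hk
      simp only [H, if_true]
      refine l.hasStrictFDerivAt.congr_fderiv ?_
      ext j
      simp [B', hB, l, Matrix.mulVec, dotProduct]
    · simp only [H, if_neg hk]
      refine (hasStrictFDerivAt_aeval (f k) q).congr_fderiv ?_
      ext j
      simp [B', hB, hk, jacobianMatrix, Matrix.mulVec, dotProduct]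
  refine ⟨(hH.toOpenPartialHomeomorph H).source,
    (hH.toOpenPartialHomeomorph H).open_source.mem_nhds hH.mem_toOpenPartialHomeomorph_source,
    l, ?_, ?_⟩
  · rw [hl, sum_mul_aeval_adjugate]
    exact hw
  · rintro x ⟨hx, hx'⟩ y ⟨hy, hy'⟩ hxy
    refine (hH.toOpenPartialHomeomorph H).injOn hx hy ?_
    funext k
    by_cases hk : k = k₀
    · simpa [H, hk] using hxy
    · simp [H, hk, hx' k hk, hy' k hk]

theorem finite_and_even_ncard_fiber (f : ι → MvPolynomial ι ℚ) {p : ι → ℝ}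
    (hp : AlgebraicIndependent ℚ p)
    (hf : LinearIndependent ℝ (fun k i => aeval p (pderiv i (f k)))) (k₀ : ι)
    (hM : Bornology.IsBounded {x : ι → ℝ | ∀ k ≠ k₀, aeval x (f k) = aeval p (f k)}) :
    {x ∈ connectedComponentIn {x : ι → ℝ | ∀ k ≠ k₀, aeval x (f k) = aeval p (f k)} p |
      aeval x (f k₀) = aeval p (f k₀)}.Finite ∧
    Even {x ∈ connectedComponentIn {x : ι → ℝ | ∀ k ≠ k₀, aeval x (f k) = aeval p (f k)} p |
      aeval x (f k₀) = aeval p (f k₀)}.ncard := by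
  set M := {x : ι → ℝ | ∀ k ≠ k₀, aeval x (f k) = aeval p (f k)} with hMdef
  have hind : AlgebraicIndependent ℚ (fun k => aeval p (f k)) :=
    algebraicIndependent_of_jacobian f p hp hf
  obtain ⟨χ, K, L, hX, hL, hχ⟩ :=
    exists_cutoff_vectorField (fun i => (jacobianMatrix f).adjugate i k₀) hM
  set X : (ι → ℝ) → ι → ℝ := fun x => χ x • fun i => aeval x ((jacobianMatrix f).adjugate i k₀)
    with hXdef
  have hfX : ∀ k x, (∑ i, aeval x (pderiv i (f k)) •
      ContinuousLinearMap.proj (R := ℝ) (φ := fun _ : ι => ℝ) i) (X x) =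
      χ x * if k = k₀ then aeval x (jacobianMatrix f).det else 0 := by
    intro k x
    rw [← sum_jacobian_mul_adjugate, Finset.mul_sum]
    simp only [X, map_smul]
    simp [Finset.mul_sum]
  have hcl : IsClosed M := by
    simp only [hMdef, Set.ofPred_forall]
    exact isClosed_iInter fun k => isClosed_iInter fun _ =>
      isClosed_eq (contDiff_aeval (f k)).continuous continuous_const
  have key := finite_and_even_ncard_zeros (M := M) (p := p) hX hL
    (Metric.isCompact_of_isClosed_isBounded hcl hM) ?_ ?_
    (g := fun x => aeval x (f k₀) - aeval p (f k₀))
    (fun x => (hasStrictFDerivAt_aeval (f k₀) x).hasFDerivAt.sub_const _) ?_ (by simp [hMdef])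
  · simpa only [sub_eq_zero] using key
  · intro γ hγ h0 t k hk
    have hd : ∀ t, HasDerivAt (fun t => aeval (γ t) (f k)) 0 t := by
      intro t
      have := (hasStrictFDerivAt_aeval (f k) (γ t)).hasFDerivAt.comp_hasDerivAt t (hγ t)
      rw [hfX, if_neg hk, mul_zero] at this
      exact this
    rw [← h0 k hk]
    exact is_const_of_deriv_eq_zero (fun t => (hd t).differentiableAt) (fun t => (hd t).deriv) t 0
  · intro q hq
    have hq' : AlgebraicIndependent ℚ (fun k : {k // k ≠ k₀} => aeval q (f k)) := by
      have := hind.comp (Subtype.val : {k // k ≠ k₀} → ι) Subtype.val_injective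
      convert this using 2 with k
      exact hq k k.2
    obtain ⟨U, hU, l, hl, hinj⟩ := exists_nhds_injOn f k₀ q (linearIndependent_jacobian _ q hq')
    refine ⟨U, hU, l, ?_, ?_⟩
    · simpa [X, hχ q hq] using hl
    · convert hinj using 3
      ext x
      refine forall₂_congr fun k hk => ?_
      rw [hq k hk]
  · intro x hx hx0
    rw [hfX, if_pos rfl, hχ x hx, one_mul]
    have hx' : AlgebraicIndependent ℚ (fun k => aeval x (f k)) := by
      convert hind using 2 with k
      by_cases hk : k = k₀
      · subst hk; exact sub_eq_zero.1 hx0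
      · exact hx k hk
    have hli := linearIndependent_jacobian f x hx'
    have hu : IsUnit ((jacobianMatrix f).map (aeval x)) :=
      Matrix.linearIndependent_rows_iff_isUnit.1 hli
    rw [Matrix.isUnit_iff_isUnit_det] at hu
    have := AlgHom.map_det (aeval x : MvPolynomial ι ℚ →ₐ[ℚ] ℝ) (jacobianMatrix f)
    rw [this]
    exact hu.ne_zero

end PolynomialSystem

section Rigidity
open MvPolynomial
variable {V : Type*} {G : SimpleGraph V} {P : Set V} {p : V → Plane}

theorem exists_ne_zero_orthogonal (d : Plane) : ∃ t : Fin 2 → ℝ, t ≠ 0 ∧ ∑ i, d i * t i = 0 := by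
  by_cases hd : d = 0
  · exact ⟨1, one_ne_zero, by simp [hd]⟩
  · refine ⟨![-d 1, d 0], fun h => hd ?_, by simp [Fin.sum_univ_two]; ring⟩
    ext i
    have h0 := congr_fun h 0
    have h1 := congr_fun h 1
    fin_cases i <;> simp_all

theorem exists_dist_le_of_reachable {u₀ v₀ v w : V}
    (h : (G.deleteEdges {s(u₀, v₀)}).Reachable v w) :
    ∃ R, ∀ q ∈ flexSpace G P p s(u₀, v₀), dist (q v) (q w) ≤ R := by
  obtain ⟨W⟩ := h
  induction W with
  | nil => exact ⟨0, by simp⟩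
  | @cons a b c hab W ih =>
    obtain ⟨R, hR⟩ := ih
    rw [SimpleGraph.deleteEdges_adj] at hab
    refine ⟨dist (p a) (p b) + R, fun q hq => (dist_triangle _ (q b) _).trans ?_⟩
    rw [hq.2 hab.1 hab.2]
    gcongr
    exact hR q hq

variable (V) in
def coordHomeomorph : (V × Fin 2 → ℝ) ≃ₜ (V → Plane) where
  toFun x v := WithLp.toLp 2 fun i => x (v, i)
  invFun q vi := q vi.1 vi.2
  left_inv _ := rfl
  right_inv _ := rfl
  continuous_toFun := by fun_prop
  continuous_invFun := by fun_prop

def edgePolynomial (e : Sym2 V) : MvPolynomial (V × Fin 2) ℚ :=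
  e.lift ⟨fun u w => ∑ i, (X (u, i) - X (w, i)) ^ 2, fun u w =>
    Finset.sum_congr rfl fun i _ => by ring⟩

theorem aeval_edgePolynomial (x : V × Fin 2 → ℝ) (u w : V) :
    aeval x (edgePolynomial s(u, w)) =
      dist (coordHomeomorph V x u) (coordHomeomorph V x w) ^ 2 := by
  rw [EuclideanSpace.dist_eq, Real.sq_sqrt (by positivity)]
  simp [edgePolynomial, coordHomeomorph, Real.dist_eq, sq_abs]

theorem aeval_edgePolynomial_eq_iff (x x' : V × Fin 2 → ℝ) (u w : V) :
    aeval x (edgePolynomial s(u, w)) = aeval x' (edgePolynomial s(u, w)) ↔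
      dist (coordHomeomorph V x u) (coordHomeomorph V x w) =
        dist (coordHomeomorph V x' u) (coordHomeomorph V x' w) := by
  rw [aeval_edgePolynomial, aeval_edgePolynomial, sq_eq_sq₀ dist_nonneg dist_nonneg]

variable (G P) in
def constraintPolynomial :
    G.edgeSet ⊕ ({v : V // v ∈ P} × Fin 2) → MvPolynomial (V × Fin 2) ℚ :=
  Sum.elim (fun e => edgePolynomial e) (fun vi => X (vi.1.1, vi.2))

theorem coordHomeomorph_mem_flexSpace_iff {u₀ v₀ : V} (he : G.Adj u₀ v₀)
    (x : V × Fin 2 → ℝ) :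
    coordHomeomorph V x ∈ flexSpace G P p s(u₀, v₀) ↔
      ∀ c ≠ Sum.inl ⟨s(u₀, v₀), he⟩, aeval x (constraintPolynomial G P c) =
        aeval ((coordHomeomorph V).symm p) (constraintPolynomial G P c) := by
  have hT : coordHomeomorph V ((coordHomeomorph V).symm p) = p :=
    (coordHomeomorph V).apply_symm_apply p
  constructor
  · rintro ⟨h1, h2⟩ (⟨e, hG⟩ | ⟨⟨v, hv⟩, i⟩) hc
    · induction e using Sym2.ind with | _ u w
      rw [constraintPolynomial, Sum.elim_inl, aeval_edgePolynomial_eq_iff, hT]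
      exact h2 hG fun h => hc (by simp [h])
    · have := congr_arg (fun z : Plane => z i) (h1 v hv)
      simpa [constraintPolynomial, coordHomeomorph] using this
  · intro h
    refine ⟨fun v hv => ?_, fun u w huw hne => ?_⟩
    · ext i
      have := h (Sum.inr (⟨v, hv⟩, i)) (by simp)
      simpa [constraintPolynomial, coordHomeomorph] using this
    · have := h (Sum.inl ⟨s(u, w), huw⟩) fun h => hne (congr_arg Subtype.val (Sum.inl.inj h))
      rwa [constraintPolynomial, Sum.elim_inl, aeval_edgePolynomial_eq_iff, hT] at this

theorem sum_pderiv_edgePolynomial [Fintype V] [DecidableEq V] (x y : V × Fin 2 → ℝ) (u w : V) :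
    ∑ j, aeval x (pderiv j (edgePolynomial s(u, w))) * y j =
      2 * ∑ i, (x (u, i) - x (w, i)) * (y (u, i) - y (w, i)) := by
  have hX : ∀ a : V × Fin 2,
      ∑ j, aeval x (pderiv j (X a : MvPolynomial (V × Fin 2) ℚ)) * y j = y a := by
    intro a
    simp [pderiv_X, Pi.single_apply, apply_ite (aeval x : _ → ℝ)]
  have hE : ∀ j, aeval x (pderiv j (edgePolynomial s(u, w))) = ∑ i, 2 * (x (u, i) - x (w, i)) *
      (aeval x (pderiv j (X (u, i) : MvPolynomial (V × Fin 2) ℚ)) -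
        aeval x (pderiv j (X (w, i) : MvPolynomial (V × Fin 2) ℚ))) := by
    intro j
    simp [edgePolynomial, mul_assoc]
  simp only [hE, Finset.sum_mul]
  rw [Finset.sum_comm, Finset.mul_sum]
  refine Finset.sum_congr rfl fun i _ => ?_
  rw [← hX (u, i), ← hX (w, i), ← Finset.sum_sub_distrib, ← mul_assoc, Finset.mul_sum]
  exact Finset.sum_congr rfl fun j _ => by ring

variable [Fintype V] [DecidableEq V] [DecidableRel G.Adj] [DecidablePred (· ∈ P)]

theorem PinnedIsostatic.eq_zero_of_infinitesimal_motion
    (h : PinnedIsostatic G P p) {y : V × Fin 2 → ℝ} (hy : ∀ v ∈ P, ∀ i, y (v, i) = 0)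
    (hG : ∀ u w, G.Adj u w → ∑ i, (p u i - p w i) * (y (u, i) - y (w, i)) = 0) : y = 0 := by
  set A := pinnedRigidityMatrix G P p
  have hker : LinearMap.ker A.mulVecLin = ⊥ := by
    have h1 := A.mulVecLin.finrank_range_add_finrank_ker
    have h2 : Module.finrank ℝ (LinearMap.range A.mulVecLin) = _ := h.2
    rw [h2, Module.finrank_fintype_fun_eq_card, Fintype.card_prod, Fintype.card_fin] at h1
    exact Submodule.finrank_eq_zero.1 (by lia)
  have hz : (fun vi : {v : V // v ∉ P} × Fin 2 => y (vi.1, vi.2)) ∈ LinearMap.ker A.mulVecLin := by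
    rw [LinearMap.mem_ker]
    funext ⟨e, he⟩
    induction e using Sym2.ind with | _ u w
    have huw : G.Adj u w := he
    have hne := huw.ne
    let c : V → Fin 2 → ℝ := fun v i =>
      if v = u then p u i - p w i else if v = w then p w i - p u i else 0
    have hA : ∀ vi : {v : V // v ∉ P} × Fin 2, A ⟨s(u, w), he⟩ vi = c vi.1 vi.2 := by
      rintro ⟨⟨v, hv⟩, i⟩
      simp only [A, pinnedRigidityMatrix, c]
      split_ifs with h1 h2 h3 h4 h5
      · subst h2
        have := Sym2.other_spec h1
        rw [Sym2.congr_right] at this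
        rw [this]
        rfl
      · subst h3
        have := (Sym2.other_spec h1).trans Sym2.eq_swap
        rw [Sym2.congr_right] at this
        rw [this]
        rfl
      · rcases Sym2.mem_iff.1 h1 with h | h <;> contradiction
      · simp_all
      · simp_all
      · rfl
    have hsum : ∑ v : {v : V // v ∉ P}, ∑ i, c v i * y (v, i) = ∑ v, ∑ i, c v i * y (v, i) := by
      refine (Finset.sum_subtype (Finset.univ.filter (· ∉ P)) (by simp)
        fun v => ∑ i, c v i * y (v, i)).symm.trans (Finset.sum_filter_of_ne fun v _ hv hvP => hv ?_)
      simp [hy v hvP]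
    rw [Matrix.mulVecLin_apply, Matrix.mulVec, dotProduct, Fintype.sum_prod_type]
    simp only [hA, hsum, Pi.zero_apply]
    rw [← Finset.sum_subset (Finset.subset_univ {u, w}), Finset.sum_pair hne, ← hG u w huw,
      ← Finset.sum_add_distrib]
    · refine Finset.sum_congr rfl fun i _ => ?_
      simp only [c, if_pos, if_neg hne.symm]
      ring
    · intro v _ hv
      simp only [Finset.mem_insert, Finset.mem_singleton, not_or] at hv
      simp [c, hv.1, hv.2]
  rw [hker, Submodule.mem_bot] at hz
  funext ⟨v, i⟩
  by_cases hv : v ∈ P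
  · exact hy v hv i
  · exact congr_fun hz (⟨v, hv⟩, i)

theorem PinnedIsostatic.exists_reachable_pinned
    (h : PinnedIsostatic G P p) (u₀ v₀ v : V) :
    ∃ w ∈ P, (G.deleteEdges {s(u₀, v₀)}).Reachable v w := by
  classical
  by_contra! hcon
  set H := G.deleteEdges {s(u₀, v₀)} with hH
  obtain ⟨t, ht, hdt⟩ := exists_ne_zero_orthogonal (p u₀ - p v₀)
  let y : V × Fin 2 → ℝ := fun xi => if H.Reachable v xi.1 then t xi.2 else 0
  have hy : y = 0 := by
    refine h.eq_zero_of_infinitesimal_motion (fun w hw i => if_neg (hcon w hw)) fun a b hab => ?_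
    by_cases hs : s(a, b) = s(u₀, v₀)
    · have hd : ∑ i, (p a i - p b i) * t i = 0 := by
        rcases Sym2.eq_iff.1 hs with ⟨rfl, rfl⟩ | ⟨rfl, rfl⟩
        · simpa using hdt
        · rw [← neg_eq_zero, ← Finset.sum_neg_distrib]
          simpa [← neg_mul] using hdt
      by_cases ha : H.Reachable v a <;> by_cases hb : H.Reachable v b <;>
        simp only [y, ha, hb, if_true, if_false, sub_self, mul_zero, sub_zero, zero_sub, mul_neg,
          Finset.sum_neg_distrib, hd, neg_zero, Finset.sum_const_zero]
    · have hab' : H.Adj a b := by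
        rw [hH, SimpleGraph.deleteEdges_adj]
        exact ⟨hab, hs⟩
      have : H.Reachable v a ↔ H.Reachable v b :=
        ⟨fun hr => hr.trans hab'.reachable, fun hr => hr.trans hab'.symm.reachable⟩
      simp [y, this]
  refine ht (funext fun i => ?_)
  simpa [y] using congr_fun hy (v, i)

theorem PinnedIsostatic.exists_norm_le
    (h : PinnedIsostatic G P p) (u₀ v₀ : V) :
    ∃ R, ∀ q ∈ flexSpace G P p s(u₀, v₀), ∀ v, ‖q v‖ ≤ R := by
  have key : ∀ v, ∃ R, ∀ q ∈ flexSpace G P p s(u₀, v₀), ‖q v‖ ≤ R := by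
    intro v
    obtain ⟨w, hw, hr⟩ := h.exists_reachable_pinned u₀ v₀ v
    obtain ⟨R, hR⟩ := exists_dist_le_of_reachable (P := P) (p := p) hr
    refine ⟨R + ‖p w‖, fun q hq => ?_⟩
    have h1 := hR q hq
    rw [hq.1 w hw, dist_eq_norm] at h1
    calc ‖q v‖ = ‖(q v - p w) + p w‖ := by simp
      _ ≤ _ := (norm_add_le _ _).trans (by gcongr)
  choose R hR using key
  obtain ⟨B, hB⟩ := (Set.finite_range R).bddAbove
  exact ⟨B, fun q hq v => (hR v q hq).trans (hB ⟨v, rfl⟩)⟩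

theorem PinnedIsostatic.card_eq (h : PinnedIsostatic G P p) :
    Fintype.card (V × Fin 2) = Fintype.card (G.edgeSet ⊕ ({v : V // v ∈ P} × Fin 2)) := by
  have := Fintype.card_subtype_compl (fun v => v ∈ P)
  have := Fintype.card_subtype_le (fun v => v ∈ P)
  rw [Fintype.card_sum, h.1]
  simp only [Fintype.card_prod, Fintype.card_fin]
  lia

theorem PinnedIsostatic.linearIndependent_jacobian
    (h : PinnedIsostatic G P p)
    (σ : V × Fin 2 ≃ G.edgeSet ⊕ ({v : V // v ∈ P} × Fin 2)) :
    LinearIndependent ℝ (fun k i =>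
      aeval (fun vi : V × Fin 2 => p vi.1 vi.2) (pderiv i (constraintPolynomial G P (σ k)))) := by
  let A : Matrix (V × Fin 2) (V × Fin 2) ℝ := Matrix.of fun k i =>
    aeval (fun vi : V × Fin 2 => p vi.1 vi.2) (pderiv i (constraintPolynomial G P (σ k)))
  change LinearIndependent ℝ A.row
  rw [Matrix.linearIndependent_rows_iff_isUnit, ← Matrix.mulVec_injective_iff_isUnit]
  refine (injective_iff_map_eq_zero A.mulVecLin).2 fun y hy => ?_
  have hy' : ∀ c, ∑ i, aeval (fun vi : V × Fin 2 => p vi.1 vi.2)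
      (pderiv i (constraintPolynomial G P c)) * y i = 0 := by
    intro c
    have := congr_fun hy (σ.symm c)
    simpa [A, Matrix.mulVec, dotProduct] using this
  refine h.eq_zero_of_infinitesimal_motion (fun v hv i => ?_) fun u w huw => ?_
  · have := hy' (Sum.inr (⟨v, hv⟩, i))
    simpa [constraintPolynomial, pderiv_X, Pi.single_apply, apply_ite (aeval _ : _ → ℝ)] using this
  · have := hy' (Sum.inl ⟨s(u, w), huw⟩)
    rw [constraintPolynomial, Sum.elim_inl, sum_pderiv_edgePolynomial] at this
    simpa using this

end Rigidity

/-- On the connected component (of the configuration space of the framework with one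
edge `{u₀, v₀}` removed) containing `p`, the set of configurations at which the removed
edge returns to its original length is finite, of even cardinality, and contains at
least two elements. -/
theorem single_cut_even_number_of_solutions_on_component
    {V : Type*} [Fintype V] [DecidableEq V] (G : SimpleGraph V) [DecidableRel G.Adj]
    (P : Set V) [DecidablePred (· ∈ P)] (hP : 3 ≤ P.ncard)
    (p : V → Plane) (hgen : IsGenericConfig 2 p) (hiso : PinnedIsostatic G P p)
    (u₀ v₀ : V) (he : G.Adj u₀ v₀) :
    ({q ∈ connectedComponentIn (flexSpace G P p s(u₀, v₀)) p |
        dist (q u₀) (q v₀) = dist (p u₀) (p v₀)}).Finite ∧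
    Even ({q ∈ connectedComponentIn (flexSpace G P p s(u₀, v₀)) p |
        dist (q u₀) (q v₀) = dist (p u₀) (p v₀)}).ncard ∧
    2 ≤ ({q ∈ connectedComponentIn (flexSpace G P p s(u₀, v₀)) p |
        dist (q u₀) (q v₀) = dist (p u₀) (p v₀)}).ncard := by
  classical
  set T := coordHomeomorph V
  set x₀ : V × Fin 2 → ℝ := T.symm p with hx₀
  have hT : T x₀ = p := T.apply_symm_apply p
  let σ := Fintype.equivOfCardEq hiso.card_eq
  set k₀ := σ.symm (Sum.inl ⟨s(u₀, v₀), he⟩) with hk₀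
  let f := fun k => constraintPolynomial G P (σ k)
  set N := {x | ∀ k ≠ k₀, MvPolynomial.aeval x (f k) = MvPolynomial.aeval x₀ (f k)} with hN
  have hmem : ∀ x, x ∈ N ↔ T x ∈ flexSpace G P p s(u₀, v₀) := by
    intro x
    rw [coordHomeomorph_mem_flexSpace_iff he, ← σ.forall_congr_right]
    refine forall_congr' fun k => ?_
    rw [hk₀, Ne, Ne, Equiv.eq_symm_apply]
  have himage : T '' N = flexSpace G P p s(u₀, v₀) := by
    rw [← Set.image_preimage_eq (flexSpace G P p s(u₀, v₀)) T.surjective]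
    exact congr_arg _ (Set.ext hmem)
  have hbdd : Bornology.IsBounded N := by
    obtain ⟨R, hR⟩ := hiso.exists_norm_le u₀ v₀
    refine isBounded_iff_forall_norm_le.2 ⟨max R 0, fun x hx => ?_⟩
    refine (pi_norm_le_iff_of_nonneg (le_max_right _ _)).2 fun vi => ?_
    exact ((PiLp.norm_apply_le (T x vi.1) vi.2).trans (hR _ ((hmem x).1 hx) vi.1)).trans
      (le_max_left _ _)
  have hx₀N : x₀ ∈ N := fun _ _ => rfl
  obtain ⟨hfin, heven⟩ := finite_and_even_ncard_fiber f (p := x₀) hgen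
    (hiso.linearIndependent_jacobian σ) k₀ hbdd
  have hset : {q ∈ connectedComponentIn (flexSpace G P p s(u₀, v₀)) p |
      dist (q u₀) (q v₀) = dist (p u₀) (p v₀)} =
      T '' {x ∈ connectedComponentIn N x₀ |
        MvPolynomial.aeval x (f k₀) = MvPolynomial.aeval x₀ (f k₀)} := by
    have hf : ∀ x, MvPolynomial.aeval x (f k₀) = MvPolynomial.aeval x₀ (f k₀) ↔
        dist (T x u₀) (T x v₀) = dist (p u₀) (p v₀) := by
      intro x
      simp only [f, hk₀, Equiv.apply_symm_apply, constraintPolynomial, Sum.elim_inl]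
      rw [aeval_edgePolynomial_eq_iff, ← hT]
    rw [← himage, ← hT, ← T.image_connectedComponentIn hx₀N, hT]
    ext q
    constructor
    · rintro ⟨⟨x, hx, rfl⟩, hq⟩
      exact ⟨x, ⟨hx, (hf x).2 hq⟩, rfl⟩
    · rintro ⟨x, ⟨hx, hq⟩, rfl⟩
      exact ⟨⟨x, hx, rfl⟩, (hf x).1 hq⟩
  rw [hset, Set.ncard_image_of_injective _ T.injective]
  refine ⟨hfin.image _, heven, ?_⟩
  have hpos : 0 < {x ∈ connectedComponentIn N x₀ |
      MvPolynomial.aeval x (f k₀) = MvPolynomial.aeval x₀ (f k₀)}.ncard :=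
    (Set.ncard_pos hfin).2 ⟨x₀, mem_connectedComponentIn hx₀N, rfl⟩
  obtain ⟨m, hm⟩ := heven
  lia
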